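/- Suppose 0 < λ + μ < 1. Then every compact subset K of the state space S is small: there exist a positive integer T and a non-trivial (nonzero) measure ν on S such that for every x ∈ K and every Borel set B ⊆ S, P^T(x, B) ≥ ν(B). In particular every compact subset of S is petite. -/

import Mathlib

open MeasureTheory ProbabilityTheory Filter

noncomputable section

/-- One step of the dynamics, given current state `x = (R, Z)` and noise `n`:
`R' = R − λ·max(−R,0) + λ(λ+μ)Z + max(min(ζ, r* − R), −ξ) + n`,
`Z' = max(−R,0) + (1−λ−μ)Z`. -/
def step (lam mu zeta xi rstar : ℝ) (x : ℝ × ℝ) (n : ℝ) : ℝ × ℝ :=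
  (x.1 - lam * max (-x.1) 0 + lam * (lam + mu) * x.2
      + max (min zeta (rstar - x.1)) (-xi) + n,
   max (-x.1) 0 + (1 - lam - mu) * x.2)

/-- The Gaussian noise distribution `N(0, σ²)`. -/
def noise (sigma : ℝ) : Measure ℝ := gaussianReal 0 (sigma ^ 2).toNNReal

/-- The one-step transition kernel `P(x, ·)`: the law of `step x N` with `N ~ N(0, σ²)`. -/
def kerP (lam mu zeta xi rstar sigma : ℝ) (x : ℝ × ℝ) : Measure (ℝ × ℝ) :=
  (noise sigma).map (step lam mu zeta xi rstar x)

/-- The `n`-step transition kernel `Pⁿ(x, ·)`. -/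
def kerPn (lam mu zeta xi rstar sigma : ℝ) : ℕ → (ℝ × ℝ) → Measure (ℝ × ℝ)
  | 0, x => Measure.dirac x
  | n + 1, x => (kerP lam mu zeta xi rstar sigma x).bind (kerPn lam mu zeta xi rstar sigma n)

/-- Total variation distance between two measures: sup over Borel sets of the
absolute difference. -/
def tvDist (m1 m2 : Measure (ℝ × ℝ)) : ℝ :=
  ⨆ B : { B : Set (ℝ × ℝ) // MeasurableSet B }, |(m1 B).toReal - (m2 B).toReal|

end

open Set

theorem measurable_step (lam mu zeta xi rstar : ℝ) :
    Measurable fun q : (ℝ × ℝ) × ℝ => step lam mu zeta xi rstar q.1 q.2 := by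
  unfold step
  fun_prop

theorem measurable_step_right (lam mu zeta xi rstar : ℝ) (x : ℝ × ℝ) :
    Measurable (step lam mu zeta xi rstar x) :=
  (measurable_step lam mu zeta xi rstar).comp measurable_prodMk_left

instance isProbabilityMeasure_noise (sigma : ℝ) : IsProbabilityMeasure (noise sigma) := by
  unfold noise
  infer_instance

theorem measurable_kerP (lam mu zeta xi rstar sigma : ℝ) :
    Measurable (kerP lam mu zeta xi rstar sigma) := by
  refine Measure.measurable_of_measurable_coe _ fun B hB => ?_
  convert measurable_measure_prodMk_left (ν := noise sigma)
    (measurable_step lam mu zeta xi rstar hB) using 2 with x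
  rw [kerP, Measure.map_apply (measurable_step_right lam mu zeta xi rstar x) hB]
  rfl

theorem kerPn_one (lam mu zeta xi rstar sigma : ℝ) :
    kerPn lam mu zeta xi rstar sigma 1 = kerP lam mu zeta xi rstar sigma := by
  funext x
  exact Measure.bind_dirac

theorem kerPn_two_apply (lam mu zeta xi rstar sigma : ℝ) (x : ℝ × ℝ) {B : Set (ℝ × ℝ)}
    (hB : MeasurableSet B) :
    kerPn lam mu zeta xi rstar sigma 2 x B =
      ∫⁻ n, ∫⁻ m, B.indicator 1 (step lam mu zeta xi rstar (step lam mu zeta xi rstar x n) m)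
        ∂noise sigma ∂noise sigma := by
  have hP := measurable_kerP lam mu zeta xi rstar sigma
  have hPB : Measurable fun y => kerP lam mu zeta xi rstar sigma y B :=
    (Measure.measurable_coe hB).comp hP
  have h2 : kerPn lam mu zeta xi rstar sigma 2 x =
      (kerP lam mu zeta xi rstar sigma x).bind (kerPn lam mu zeta xi rstar sigma 1) := rfl
  rw [h2, kerPn_one, Measure.bind_apply hB hP.aemeasurable, kerP,
    lintegral_map hPB
      (measurable_step_right lam mu zeta xi rstar x)]
  refine lintegral_congr fun n => ?_
  rw [← lintegral_indicator_one hB, kerP,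
    lintegral_map (measurable_one.indicator hB) (measurable_step_right lam mu zeta xi rstar _)]

/-- On a bounded interval the Gaussian noise dominates a positive multiple of Lebesgue measure. -/
theorem exists_smul_restrict_le_noise {sigma : ℝ} (hsigma : 0 < sigma) (L : ℝ) :
    ∃ c : ENNReal, c ≠ 0 ∧ c • volume.restrict (Icc (-L) L) ≤ noise sigma := by
  have hv : (sigma ^ 2).toNNReal ≠ 0 := by simpa using hsigma.ne'
  refine ⟨gaussianPDF 0 (sigma ^ 2).toNNReal L, (gaussianPDF_pos 0 hv L).ne', ?_⟩
  rw [noise, gaussianReal_of_var_ne_zero 0 hv, ← withDensity_const]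
  calc (volume.restrict (Icc (-L) L)).withDensity
        (fun _ => gaussianPDF 0 (sigma ^ 2).toNNReal L)
      ≤ (volume.restrict (Icc (-L) L)).withDensity (gaussianPDF 0 (sigma ^ 2).toNNReal) := by
        refine withDensity_mono ?_
        filter_upwards [ae_restrict_mem measurableSet_Icc] with t ht
        refine ENNReal.ofReal_le_ofReal ?_
        have hsq : t ^ 2 ≤ L ^ 2 := sq_le_sq' ht.1 ht.2
        simp only [gaussianPDFReal, sub_zero]
        gcongr
    _ = (volume.withDensity (gaussianPDF 0 (sigma ^ 2).toNNReal)).restrict (Icc (-L) L) :=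
        (restrict_withDensity measurableSet_Icc _).symm
    _ ≤ _ := Measure.restrict_le_self

/-- Lower bound for a noise integral after a volume-preserving change of variables. -/
theorem mul_setLIntegral_comp_le_of_smul_restrict_le {m : Measure ℝ} {c : ENNReal}
    {s t : Set ℝ} (h : c • volume.restrict t ≤ m) {φ : ℝ → ℝ}
    (hφ : MeasurePreserving φ volume volume) (hφe : MeasurableEmbedding φ)
    (hst : MapsTo φ s t) (G : ℝ → ENNReal) :
    c * ∫⁻ z in s, G (φ z) ≤ ∫⁻ n, G n ∂m :=
  calc c * ∫⁻ z in s, G (φ z) ≤ c * ∫⁻ z in φ ⁻¹' t, G (φ z) := by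
        gcongr
        exact hst
    _ = ∫⁻ n, G n ∂(c • volume.restrict t) := by
        rw [hφ.setLIntegral_comp_preimage_emb hφe, lintegral_smul_measure, smul_eq_mul]
    _ ≤ _ := lintegral_mono' h le_rfl

/-- Corollary 3.5. Suppose `0 < λ + μ < 1`. Every compact subset `K` of the
state space `S = ℝ × [0,∞)` is small: there are `T ≥ 1` and a non-trivial measure `ν` with
`P^T(x, B) ≥ ν(B)` for all `x ∈ K` and all Borel `B` (hence every compact set is petite). -/
theorem compact_is_small
    (lam mu zeta xi rstar sigma : ℝ)
    (hlam : 0 < lam) (hzeta : 0 < zeta) (hxi : 0 < xi) (hrstar : zeta < rstar)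
    (hsigma : 0 < sigma) (hlm0 : 0 < lam + mu) (hlm1 : lam + mu < 1) :
    ∀ K : Set (ℝ × ℝ), IsCompact K → K ⊆ {p | 0 ≤ p.2} →
      ∃ T : ℕ, 0 < T ∧
        ∃ ν : Measure (ℝ × ℝ), ν ≠ 0 ∧
          ∀ x ∈ K, ∀ B : Set (ℝ × ℝ), MeasurableSet B →
            ν B ≤ kerPn lam mu zeta xi rstar sigma T x B := by
  intro K hK _
  set D : ℝ × ℝ → ℝ := fun x => x.1 - lam * max (-x.1) 0 + lam * (lam + mu) * x.2
      + max (min zeta (rstar - x.1)) (-xi) with hD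
  set W : ℝ × ℝ → ℝ := fun x => max (-x.1) 0 + (1 - lam - mu) * x.2 with hW
  have hDc : Continuous D := by fun_prop
  have hWc : Continuous W := by fun_prop
  have hstep : ∀ x n, step lam mu zeta xi rstar x n = (D x + n, W x) := fun _ _ => rfl
  set b : ℝ := 1 - lam - mu with hb
  obtain ⟨a, ha⟩ := hK.exists_bound_of_continuousOn (f := fun x => b * W x) (by fun_prop)
  -- The two noise values that lead from `x` to `(r, z)` in two steps stay bounded.
  obtain ⟨L, hL⟩ := (hK.prod ((isCompact_Icc (a := (0 : ℝ)) (b := 1)).prod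
      (isCompact_Icc (a := a) (b := a + 1)))).exists_bound_of_continuousOn
    (f := fun q : (ℝ × ℝ) × ℝ × ℝ =>
      ((b * W q.1 - D q.1) - q.2.2, q.2.1 - D (b * W q.1 - q.2.2, W q.1))) (by fun_prop)
  obtain ⟨c, hc, hcle⟩ := exists_smul_restrict_le_noise hsigma L
  refine ⟨2, two_pos, (c * c) • volume.restrict (Icc 0 1 ×ˢ Icc a (a + 1)), ?_, ?_⟩
  · intro h
    have h1 := congrArg (fun m => m univ) h
    simp [Measure.volume_eq_prod, -Icc_prod_Icc, Measure.prod_prod, hc] at h1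
  intro x hx B hB
  have hax : ∀ z ∈ Icc a (a + 1), b * W x ≤ z := fun z hz =>
    (le_abs_self _).trans ((ha x hx).trans hz.1)
  have hLx : ∀ z ∈ Icc a (a + 1), ∀ r ∈ Icc (0 : ℝ) 1,
      (b * W x - D x) - z ∈ Icc (-L) L ∧ r - D (b * W x - z, W x) ∈ Icc (-L) L := by
    intro z hz r hr
    have h := norm_prod_le_iff.1 (hL (x, r, z) ⟨hx, hr, hz⟩)
    exact ⟨abs_le.1 h.1, abs_le.1 h.2⟩
  rw [kerPn_two_apply lam mu zeta xi rstar sigma x hB, ← lintegral_indicator_one hB,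
    lintegral_smul_measure, Measure.volume_eq_prod, ← Measure.prod_restrict,
    lintegral_prod_symm' _ (measurable_one.indicator hB), smul_eq_mul, mul_assoc]
  refine le_trans ?_ (mul_setLIntegral_comp_le_of_smul_restrict_le hcle
    (Measure.measurePreserving_sub_left volume (b * W x - D x))
    (MeasurableEquiv.subLeft (b * W x - D x)).measurableEmbedding
    (fun z hz => (hLx z hz 0 (by simp)).1) _)
  gcongr c * ?_
  rw [← lintegral_const_mul _ (measurable_one.indicator hB).lintegral_prod_left']
  refine setLIntegral_mono' measurableSet_Icc fun z hz => ?_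
  have hone : step lam mu zeta xi rstar x ((b * W x - D x) - z) = (b * W x - z, W x) := by
    rw [hstep]
    congr 1
    ring
  have htwo : W (b * W x - z, W x) = z := by
    simp only [hW] at hax ⊢
    rw [max_eq_left (by linarith [hax z hz])]
    ring
  rw [hone]
  refine le_trans (le_of_eq ?_) (mul_setLIntegral_comp_le_of_smul_restrict_le hcle
    (measurePreserving_sub_right volume (D (b * W x - z, W x)))
    (MeasurableEquiv.subRight (D (b * W x - z, W x))).measurableEmbedding
    (fun r hr => (hLx z hz r hr).2) _)
  simp only [hstep, htwo, add_sub_cancel]
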